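/- Let a, b be real numbers with b > 1 and let t be real with |t| < 1. Then H(a − 1/2, a − 1; b; t) − H(a − 1, a − 3/2; b − 1; t) = ((2b + 1 − 2a)(a − 1) / (2b(b − 1))) · t · H(a, a − 1/2; b + 1; t). -/

import Mathlib

open MeasureTheory

/-- The Gauss hypergeometric series `H(a,b;c;t) = ∑_j ((a)_j (b)_j / ((c)_j j!)) t^j`. -/
noncomputable def GaussH (a b c t : ℝ) : ℝ :=
  ∑' j : ℕ, ((ascPochhammer ℝ j).eval a * (ascPochhammer ℝ j).eval b /
      ((ascPochhammer ℝ j).eval c * (j.factorial : ℝ))) * t ^ j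

/-- The function `F_N`, defined by
`F_N(x) = (Γ(N/2)Γ((N+1)/2)/Γ(N−3/2)) (1−x)^{N−5/2} H((N−1)/2,(N−2)/2;N−3/2;1−x)`
for `x < 1` and `F_N(x) = 0` for `x ≥ 1`. -/
noncomputable def Fdens (N : ℕ) (x : ℝ) : ℝ :=
  if x < 1 then
    (Real.Gamma ((N : ℝ) / 2) * Real.Gamma (((N : ℝ) + 1) / 2) /
        Real.Gamma ((N : ℝ) - 3 / 2)) *
      (1 - x) ^ ((N : ℝ) - 5 / 2) *
      GaussH (((N : ℝ) - 1) / 2) (((N : ℝ) - 2) / 2) ((N : ℝ) - 3 / 2) (1 - x)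
  else 0

/-- Left-end recursion for the Pochhammer symbol: `(x)_{n+1} = x (x+1)_n`. -/
theorem ascPochhammer_succ_eval_left (x : ℝ) (n : ℕ) :
    (ascPochhammer ℝ (n + 1)).eval x = x * (ascPochhammer ℝ n).eval (x + 1) := by
  simp [ascPochhammer_succ_left]

theorem one_le_ordinaryHypergeometricSeries_radius (a b c : ℝ) (hc : 0 < c) :
    1 ≤ (ordinaryHypergeometricSeries ℝ a b c).radius := by
  by_cases ha : ∃ k : ℕ, a = -k
  · obtain ⟨k, rfl⟩ := ha
    simp [ordinaryHypergeometric_radius_top_of_neg_nat₁]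
  by_cases hb : ∃ k : ℕ, b = -k
  · obtain ⟨k, rfl⟩ := hb
    simp [ordinaryHypergeometric_radius_top_of_neg_nat₂]
  push Not at ha hb
  refine (ordinaryHypergeometricSeries_radius_eq_one ℝ a b c fun k => ⟨?_, ?_, ?_⟩).ge
  · exact fun h => ha k (by linarith)
  · exact fun h => hb k (by linarith)
  · have : (0 : ℝ) ≤ k := k.cast_nonneg
    linarith

theorem summable_gaussH (a b c t : ℝ) (hc : 0 < c) (ht : |t| < 1) :
    Summable fun j : ℕ => ((ascPochhammer ℝ j).eval a * (ascPochhammer ℝ j).eval b /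
      ((ascPochhammer ℝ j).eval c * (j.factorial : ℝ))) * t ^ j := by
  have hmem : t ∈ Metric.eball (0 : ℝ) (ordinaryHypergeometricSeries ℝ a b c).radius := by
    refine Metric.eball_subset_eball (one_le_ordinaryHypergeometricSeries_radius a b c hc) ?_
    rw [← ENNReal.ofReal_one, Metric.eball_ofReal]
    simpa using ht
  refine ((ordinaryHypergeometricSeries ℝ a b c).summable hmem).congr fun j => ?_
  rw [ordinaryHypergeometricSeries_apply_eq, smul_eq_mul]
  field_simp

/-- Contiguous relation for the Gauss hypergeometric series:
`H(a−1/2, a−1; b; t) − H(a−1, a−3/2; b−1; t)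
  = ((2b+1−2a)(a−1)/(2b(b−1))) · t · H(a, a−1/2; b+1; t)`. -/
theorem stmt_10 (a b t : ℝ) (hb : 1 < b) (ht : |t| < 1) :
    GaussH (a - 1 / 2) (a - 1) b t - GaussH (a - 1) (a - 3 / 2) (b - 1) t
      = ((2 * b + 1 - 2 * a) * (a - 1) / (2 * b * (b - 1))) * t *
          GaussH a (a - 1 / 2) (b + 1) t := by
  have h₁ := summable_gaussH (a - 1 / 2) (a - 1) b t (by linarith) ht
  have h₂ := summable_gaussH (a - 1) (a - 3 / 2) (b - 1) t (by linarith) ht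
  unfold GaussH
  rw [← h₁.tsum_sub h₂, (h₁.sub h₂).tsum_eq_zero_add, ← tsum_mul_left]
  simp only [ascPochhammer_zero, Polynomial.eval_one, sub_self, zero_add]
  refine tsum_congr fun j => ?_
  have hb₀ : b ≠ 0 := by linarith
  have hb₁ : b - 1 ≠ 0 := by linarith
  have hbj : b + j ≠ 0 := by positivity
  have hP : (ascPochhammer ℝ j).eval (b + 1) ≠ 0 :=
    (ascPochhammer_pos j (b + 1) (by linarith)).ne'
  have hQ : (ascPochhammer ℝ j).eval b = b * (ascPochhammer ℝ j).eval (b + 1) / (b + j) := by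
    rw [eq_div_iff hbj, ← ascPochhammer_succ_eval, ascPochhammer_succ_eval_left]
  have hj : (j : ℝ) + 1 ≠ 0 := by positivity
  rw [ascPochhammer_succ_eval_left (a - 1), ascPochhammer_succ_eval_left (a - 3 / 2),
    ascPochhammer_succ_eval_left b, ascPochhammer_succ_eval_left (b - 1),
    ascPochhammer_succ_eval, Nat.factorial_succ, sub_add_cancel, sub_add_cancel, hQ,
    show a - 3 / 2 + 1 = a - 1 / 2 by ring]
  push_cast
  field_simp
  ring
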